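/- arXiv:math/0511566 — 2 statements merged into one kernel-verified Lean document; each statement's English description precedes it below -/
import Mathlib

section
/- Assume Σ_{k≥1} k·h_k < ∞ and set σ₁(n) := Σ_{k=n+1}^∞ k·h_k. Then there exists a family of p×p matrix-valued functions Ṽ_n, n ≥ 0, each analytic in the open unit disk 𝔻 and continuous on the closed unit disk 𝔻̄, such that for every z ∈ 𝔻̄ the series Σ_{k=n+1}^∞ J̃(n,k,z) Ṽ_k(z) converges absolutely, Ṽ_n(z) = I + Σ_{k=n+1}^∞ J̃(n,k,z) Ṽ_k(z), and ‖Ṽ_n(z) − I‖ ≤ σ₁(n) · exp(σ₁(n)) for all z ∈ 𝔻̄ and n ≥ 0. -/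
open Filter Metric

attribute [local instance] Matrix.linftyOpNormedAddCommGroup Matrix.linftyOpNormedRing

noncomputable section

/-- `g̃(n,k,z) = z^(k-n) g(n,k,z)`, extended to a polynomial in `z`. -/
def greenKerTil (z : ℂ) (n k : ℕ) : ℂ :=
  if n < k then z * ∑ j ∈ Finset.range (k - n), z ^ (2 * j) else 0

/-- `J̃(n,k,z) = z^(k-n) J(n,k,z) = -g̃(n,k,z) B̃_k + z·g̃(n,k-1,z) (I - C̃_{k-1})`. -/
def JkerTil (p : ℕ) (B C : ℕ → Matrix (Fin p) (Fin p) ℂ) (z : ℂ) (n k : ℕ) :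
    Matrix (Fin p) (Fin p) ℂ :=
  -(greenKerTil z n k) • B k + (z * greenKerTil z n (k - 1)) • (1 - C (k - 1))

/-- `h_k = ‖B̃_k‖ + ‖I - C̃_{k-1}‖` in the row-sum norm. -/
def hSeq (p : ℕ) (B C : ℕ → Matrix (Fin p) (Fin p) ℂ) (k : ℕ) : ℝ :=
  ‖B k‖ + ‖(1 : Matrix (Fin p) (Fin p) ℂ) - C (k - 1)‖

/-- `σ₁(n) = Σ_{k=n+1}^∞ k·h_k`. -/
def sigma1 (p : ℕ) (B C : ℕ → Matrix (Fin p) (Fin p) ℂ) (n : ℕ) : ℝ :=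
  ∑' k : ℕ, ((n + 1 + k : ℕ) : ℝ) * hSeq p B C (n + 1 + k)

/-- The `m`-th Picard term of the Volterra equation `V n = 1 + ∑_{k > n} K n k * V k`. -/
def volterraTerm {R : Type*} [NormedRing R] (K : ℕ → ℕ → ℂ → R) : ℕ → ℕ → ℂ → R
  | 0, _, _ => 1
  | m + 1, n, z => ∑' k, K n (n + 1 + k) z * volterraTerm K m (n + 1 + k) z

/-- The tail sum `∑_{k > n} a k`. -/
def tailSum (a : ℕ → ℝ) (n : ℕ) : ℝ := ∑' k, a (n + 1 + k)

lemma summable_add_left {a : ℕ → ℝ} (ha : Summable a) (n : ℕ) :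
    Summable (fun k => a (n + k)) := by
  simpa only [add_comm n] using (summable_nat_add_iff n).2 ha

lemma tailSum_nonneg {a : ℕ → ℝ} (h0 : ∀ k, 0 ≤ a k) (n : ℕ) : 0 ≤ tailSum a n :=
  tsum_nonneg fun _ => h0 _

lemma tailSum_eq_add {a : ℕ → ℝ} (ha : Summable a) (n : ℕ) :
    tailSum a n = a (n + 1) + tailSum a (n + 1) := by
  unfold tailSum
  rw [(summable_add_left ha (n + 1)).tsum_eq_zero_add]
  simp only [add_left_comm, add_comm]

lemma tailSum_antitone {a : ℕ → ℝ} (h0 : ∀ k, 0 ≤ a k) (ha : Summable a) :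
    Antitone (tailSum a) :=
  antitone_nat_of_succ_le fun n => by linarith [tailSum_eq_add ha n, h0 (n + 1)]

lemma mul_sub_mul_pow_le_pow_sub_pow {x y : ℝ} (hy : 0 ≤ y) (hxy : y ≤ x) (m : ℕ) :
    (m + 1) * ((x - y) * y ^ m) ≤ x ^ (m + 1) - y ^ (m + 1) := by
  induction m with
  | zero => simp
  | succ m ih =>
    have h1 := mul_le_mul_of_nonneg_left ih hy
    have h2 : y ^ (m + 1) * (x - y) ≤ x ^ (m + 1) * (x - y) :=
      mul_le_mul_of_nonneg_right (pow_le_pow_left₀ hy hxy _) (sub_nonneg.2 hxy)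
    push_cast
    calc ((m : ℝ) + 1 + 1) * ((x - y) * y ^ (m + 1))
        = y * ((m + 1) * ((x - y) * y ^ m)) + y ^ (m + 1) * (x - y) := by ring
      _ ≤ y * (x ^ (m + 1) - y ^ (m + 1)) + x ^ (m + 1) * (x - y) := add_le_add h1 h2
      _ = x ^ (m + 1 + 1) - y ^ (m + 1 + 1) := by ring

lemma summable_mul_tailSum_pow {a : ℕ → ℝ} (h0 : ∀ k, 0 ≤ a k) (ha : Summable a) (m n : ℕ) :
    Summable (fun k => a (n + 1 + k) * (tailSum a (n + 1 + k) ^ m / m.factorial)) := by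
  refine Summable.of_nonneg_of_le (fun k => ?_) (fun k => ?_)
    ((summable_add_left ha (n + 1)).mul_right (tailSum a 0 ^ m / m.factorial))
  · have := tailSum_nonneg h0 (n + 1 + k)
    have := h0 (n + 1 + k)
    positivity
  · have := tailSum_nonneg h0 (n + 1 + k)
    have := h0 (n + 1 + k)
    have := tailSum_antitone h0 ha (Nat.zero_le (n + 1 + k))
    gcongr

lemma tsum_mul_tailSum_pow_le {a : ℕ → ℝ} (h0 : ∀ k, 0 ≤ a k) (ha : Summable a) (m n : ℕ) :
    ∑' k, a (n + 1 + k) * (tailSum a (n + 1 + k) ^ m / m.factorial) ≤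
      tailSum a n ^ (m + 1) / (m + 1).factorial := by
  have hterm (k : ℕ) : a (n + 1 + k) * (tailSum a (n + 1 + k) ^ m / m.factorial) ≤
      tailSum a (n + k) ^ (m + 1) / (m + 1).factorial -
        tailSum a (n + (k + 1)) ^ (m + 1) / (m + 1).factorial := by
    have h := tailSum_eq_add ha (n + k)
    have e : n + k + 1 = n + 1 + k := by omega
    rw [e] at h
    have hb := mul_sub_mul_pow_le_pow_sub_pow (tailSum_nonneg h0 (n + 1 + k))
      (x := tailSum a (n + k)) (by linarith [h0 (n + 1 + k)]) m
    rw [show n + (k + 1) = n + 1 + k by omega, ← sub_div, le_div_iff₀ (by positivity),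
      Nat.factorial_succ]
    have hf : (m.factorial : ℝ) ≠ 0 := by positivity
    refine le_trans (le_of_eq ?_) hb
    rw [h]
    push_cast
    field_simp
    ring
  refine Real.tsum_le_of_sum_range_le (fun k => ?_) (fun N => ?_)
  · have := tailSum_nonneg h0 (n + 1 + k)
    have := h0 (n + 1 + k)
    positivity
  · refine (Finset.sum_le_sum fun k _ => hterm k).trans ?_
    rw [Finset.sum_range_sub' (fun k => tailSum a (n + k) ^ (m + 1) / (m + 1).factorial)]
    have := tailSum_nonneg h0 (n + N)
    have : 0 ≤ tailSum a (n + N) ^ (m + 1) / (m + 1).factorial := by positivity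
    simpa using this

section Volterra

variable {R : Type*} [NormedRing R] [NormOneClass R] {K : ℕ → ℕ → ℂ → R} {a : ℕ → ℝ}

lemma norm_volterraTerm_le (h0 : ∀ k, 0 ≤ a k) (ha : Summable a) {z : ℂ}
    (hK : ∀ n k, ‖K n k z‖ ≤ a k) (m n : ℕ) :
    ‖volterraTerm K m n z‖ ≤ tailSum a n ^ m / m.factorial := by
  induction m generalizing n with
  | zero => simp [volterraTerm]
  | succ m ih =>
    refine (tsum_of_norm_bounded (summable_mul_tailSum_pow h0 ha m n).hasSum fun k => ?_).trans
      (tsum_mul_tailSum_pow_le h0 ha m n)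
    exact (norm_mul_le _ _).trans (mul_le_mul (hK _ _) (ih _) (norm_nonneg _) (h0 _))

lemma norm_mul_volterraTerm_le (h0 : ∀ k, 0 ≤ a k) (ha : Summable a) {z : ℂ}
    (hK : ∀ n k, ‖K n k z‖ ≤ a k) (m n k : ℕ) :
    ‖K n k z * volterraTerm K m k z‖ ≤ a k * (tailSum a 0 ^ m / m.factorial) := by
  refine (norm_mul_le _ _).trans (mul_le_mul (hK _ _) ?_ (norm_nonneg _) (h0 _))
  refine (norm_volterraTerm_le h0 ha hK m k).trans ?_
  have := tailSum_nonneg h0 k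
  have := tailSum_antitone h0 ha (Nat.zero_le k)
  gcongr

lemma diffContOnCl_tsum {E ι : Type*} [NormedAddCommGroup E] [NormedSpace ℂ E] [CompleteSpace E]
    {f : ι → ℂ → E} {u : ι → ℝ} (hu : Summable u)
    (hf : ∀ i, DiffContOnCl ℂ (f i) (ball 0 1))
    (hfu : ∀ i, ∀ z ∈ closedBall (0 : ℂ) 1, ‖f i z‖ ≤ u i) :
    DiffContOnCl ℂ (fun z => ∑' i, f i z) (ball 0 1) := by
  have hcl : closure (ball (0 : ℂ) 1) = closedBall 0 1 := closure_ball 0 one_ne_zero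
  refine ⟨Complex.differentiableOn_tsum_of_summable_norm hu (fun i => (hf i).differentiableOn) isOpen_ball
    fun i z hz => hfu i z (ball_subset_closedBall hz), ?_⟩
  rw [hcl]
  exact continuousOn_tsum (fun i => hcl ▸ (hf i).continuousOn) hu hfu

variable [NormedAlgebra ℂ R] [CompleteSpace R]

lemma diffContOnCl_volterraTerm (h0 : ∀ k, 0 ≤ a k) (ha : Summable a)
    (hd : ∀ n k, Differentiable ℂ (K n k))
    (hK : ∀ z ∈ closedBall (0 : ℂ) 1, ∀ n k, ‖K n k z‖ ≤ a k) (m n : ℕ) :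
    DiffContOnCl ℂ (volterraTerm K m n) (ball 0 1) := by
  induction m generalizing n with
  | zero => exact diffContOnCl_const
  | succ m ih =>
    refine diffContOnCl_tsum ((summable_add_left ha (n + 1)).mul_right _) (fun k => ?_)
      fun k z hz => norm_mul_volterraTerm_le h0 ha (hK z hz) m n (n + 1 + k)
    exact ⟨(hd _ _).differentiableOn.mul (ih _).differentiableOn,
      (hd _ _).continuous.continuousOn.mul (ih _).continuousOn⟩

theorem exists_volterra_solution (h0 : ∀ k, 0 ≤ a k) (ha : Summable a)
    (hd : ∀ n k, Differentiable ℂ (K n k))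
    (hK : ∀ z ∈ closedBall (0 : ℂ) 1, ∀ n k, ‖K n k z‖ ≤ a k) :
    ∃ V : ℕ → ℂ → R, ∀ n, DiffContOnCl ℂ (V n) (ball 0 1) ∧ ∀ z ∈ closedBall (0 : ℂ) 1,
      Summable (fun k => ‖K n (n + 1 + k) z * V (n + 1 + k) z‖) ∧
      HasSum (fun k => K n (n + 1 + k) z * V (n + 1 + k) z) (V n z - 1) ∧
      ‖V n z - 1‖ ≤ tailSum a n * Real.exp (tailSum a n) := by
  have hbound (m n : ℕ) (z : ℂ) (hz : z ∈ closedBall (0 : ℂ) 1) :=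
    norm_volterraTerm_le h0 ha (hK z hz) m n
  have hsm (n : ℕ) (z : ℂ) (hz : z ∈ closedBall (0 : ℂ) 1) :
      Summable (fun m => volterraTerm K m n z) :=
    (Real.summable_pow_div_factorial (tailSum a n)).of_norm_bounded fun m => hbound m n z hz
  have hsub (n : ℕ) (z : ℂ) (hz : z ∈ closedBall (0 : ℂ) 1) :
      ∑' m, volterraTerm K m n z - 1 = ∑' m, volterraTerm K (m + 1) n z := by
    rw [(hsm n z hz).tsum_eq_zero_add]
    simp [volterraTerm]
  have hnorm (n : ℕ) (z : ℂ) (hz : z ∈ closedBall (0 : ℂ) 1) :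
      ‖∑' m, volterraTerm K m n z‖ ≤ Real.exp (tailSum a n) := by
    refine tsum_of_norm_bounded ?_ fun m => hbound m n z hz
    rw [Real.exp_eq_exp_ℝ]
    exact NormedSpace.expSeries_div_hasSum_exp _
  refine ⟨fun n z => ∑' m, volterraTerm K m n z, fun n => ⟨?_, fun z hz => ?_⟩⟩
  · exact diffContOnCl_tsum (Real.summable_pow_div_factorial (tailSum a n))
      (fun m => diffContOnCl_volterraTerm h0 ha hd hK m n) fun m z hz => hbound m n z hz
  have hle (k : ℕ) : ‖K n (n + 1 + k) z * ∑' m, volterraTerm K m (n + 1 + k) z‖ ≤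
      a (n + 1 + k) * Real.exp (tailSum a n) := by
    refine (norm_mul_le _ _).trans (mul_le_mul (hK z hz _ _) ?_ (norm_nonneg _) (h0 _))
    exact (hnorm _ z hz).trans (Real.exp_le_exp.2 (tailSum_antitone h0 ha (by omega)))
  have hsn : Summable (fun k => a (n + 1 + k) * Real.exp (tailSum a n)) :=
    (summable_add_left ha (n + 1)).mul_right _
  have hS : Summable (fun k => ‖K n (n + 1 + k) z * ∑' m, volterraTerm K m (n + 1 + k) z‖) :=
    Summable.of_nonneg_of_le (fun _ => norm_nonneg _) hle hsn
  have hprod : Summable (Function.uncurry fun k m =>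
      K n (n + 1 + k) z * volterraTerm K m (n + 1 + k) z) := by
    refine Summable.of_norm_bounded (g := fun x : ℕ × ℕ =>
      a (n + 1 + x.1) * (tailSum a 0 ^ x.2 / x.2.factorial)) ?_
      fun x => norm_mul_volterraTerm_le h0 ha (hK z hz) x.2 n (n + 1 + x.1)
    have := tailSum_nonneg h0 0
    exact (summable_add_left ha (n + 1)).mul_of_nonneg
      (Real.summable_pow_div_factorial (tailSum a 0)) (fun _ => h0 _) fun m => by positivity
  have heq : ∑' k, K n (n + 1 + k) z * ∑' m, volterraTerm K m (n + 1 + k) z =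
      ∑' m, volterraTerm K m n z - 1 := by
    rw [hsub n z hz]
    simp only [volterraTerm, ← (hsm _ z hz).tsum_mul_left]
    exact hprod.tsum_comm.symm
  refine ⟨hS, heq ▸ hS.of_norm.hasSum, ?_⟩
  rw [← heq, tailSum, ← tsum_mul_right]
  exact tsum_of_norm_bounded hsn.hasSum hle

end Volterra

lemma norm_greenKerTil_le {z : ℂ} (hz : ‖z‖ ≤ 1) (n k : ℕ) : ‖greenKerTil z n k‖ ≤ k := by
  unfold greenKerTil
  split_ifs with h
  · have hs : ‖∑ j ∈ Finset.range (k - n), z ^ (2 * j)‖ ≤ ∑ j ∈ Finset.range (k - n), (1 : ℝ) :=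
      norm_sum_le_of_le _ fun j _ => by
        rw [norm_pow]
        exact pow_le_one₀ (norm_nonneg _) hz
    have hkn : ((k - n : ℕ) : ℝ) ≤ k := by exact_mod_cast Nat.sub_le k n
    rw [norm_mul]
    simp only [Finset.sum_const, Finset.card_range, nsmul_eq_mul, mul_one] at hs
    exact (mul_le_of_le_one_left (norm_nonneg _) hz).trans (hs.trans hkn)
  · simp

lemma differentiable_greenKerTil (n k : ℕ) : Differentiable ℂ fun z => greenKerTil z n k := by
  unfold greenKerTil
  split_ifs <;> fun_prop

attribute [local instance] Matrix.linftyOpNormedSpace Matrix.linftyOpNormedAlgebra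

lemma norm_JkerTil_le {p : ℕ} (B C : ℕ → Matrix (Fin p) (Fin p) ℂ) {z : ℂ} (hz : ‖z‖ ≤ 1)
    (n k : ℕ) : ‖JkerTil p B C z n k‖ ≤ k * hSeq p B C k := by
  unfold JkerTil hSeq
  rw [mul_add]
  refine (norm_add_le _ _).trans (add_le_add ?_ ?_)
  · rw [norm_smul, norm_neg]
    exact mul_le_mul_of_nonneg_right (norm_greenKerTil_le hz n k) (norm_nonneg _)
  · rw [norm_smul, norm_mul]
    refine mul_le_mul_of_nonneg_right ?_ (norm_nonneg _)
    refine (mul_le_of_le_one_left (norm_nonneg _) hz).trans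
      ((norm_greenKerTil_le hz n (k - 1)).trans ?_)
    exact_mod_cast Nat.sub_le k 1

lemma differentiable_JkerTil {p : ℕ} (B C : ℕ → Matrix (Fin p) (Fin p) ℂ) (n k : ℕ) :
    Differentiable ℂ fun z => JkerTil p B C z n k := by
  have h1 := differentiable_greenKerTil n k
  have h2 := differentiable_greenKerTil n (k - 1)
  exact (h1.neg.smul_const _).add ((differentiable_id.mul h2).smul_const _)

/-- Assume `Σ k·h_k < ∞`.  Then there is a family of matrix-valued
functions `Ṽ_n`, analytic in the open unit disk and continuous on the closed unit disk,
such that for every `z` in the closed disk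
`Ṽ_n(z) = I + Σ_{k=n+1}^∞ J̃(n,k,z) Ṽ_k(z)` (with absolute convergence) and
`‖Ṽ_n(z) - I‖ ≤ σ₁(n) exp(σ₁(n))`. -/
theorem statement6 (p : ℕ) (hp : 1 ≤ p)
    (B C : ℕ → Matrix (Fin p) (Fin p) ℂ) (hC0 : C 0 = 1)
    (hsum : Summable (fun k : ℕ => ((k + 1 : ℕ) : ℝ) * hSeq p B C (k + 1))) :
    ∃ Vt : ℕ → ℂ → Matrix (Fin p) (Fin p) ℂ,
      ∀ n : ℕ,
        (∀ i j : Fin p, DifferentiableOn ℂ (fun z => Vt n z i j) (ball (0 : ℂ) 1)) ∧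
        ContinuousOn (Vt n) (closedBall (0 : ℂ) 1) ∧
        ∀ z ∈ closedBall (0 : ℂ) 1,
          Summable (fun k : ℕ => ‖JkerTil p B C z n (n + 1 + k) * Vt (n + 1 + k) z‖) ∧
          HasSum (fun k : ℕ => JkerTil p B C z n (n + 1 + k) * Vt (n + 1 + k) z)
            (Vt n z - 1) ∧
          ‖Vt n z - 1‖ ≤ sigma1 p B C n * Real.exp (sigma1 p B C n) := by
  have : NeZero p := ⟨by omega⟩
  have : CompleteSpace (Matrix (Fin p) (Fin p) ℂ) := FiniteDimensional.complete ℂ _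
  have h0 (k : ℕ) : 0 ≤ (k : ℝ) * hSeq p B C k := by
    unfold hSeq
    positivity
  obtain ⟨V, hV⟩ := exists_volterra_solution h0
    ((summable_nat_add_iff 1).1 hsum) (differentiable_JkerTil B C)
    fun z hz n k => norm_JkerTil_le B C (mem_closedBall_zero_iff.1 hz) n k
  refine ⟨V, fun n => ⟨fun i j => ?_, ?_, (hV n).2⟩⟩
  · exact (Matrix.entryLinearMap ℂ ℂ i j).toContinuousLinearMap.differentiable.comp_differentiableOn
      (hV n).1.differentiableOn
  · rw [← closure_ball (0 : ℂ) one_ne_zero]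
    exact (hV n).1.continuousOn

end
end

section
/- Let Q be a nonconstant polynomial with complex coefficients. Then the complement ℂ \ Q^{−1}([−2,2]) of the preimage of the real interval [−2,2] under Q is a connected subset of ℂ. (In particular, for a quasi-symmetric p-periodic Jacobi matrix J⁰ with Burchnall–Chaundy polynomial normalized so that σ(J⁰) = Q^{−1}([−2,2]), the complement of the spectrum of J⁰ is connected.) -/
/-- Boundary points of a connected component of an open set `W` lie outside `W`. -/
theorem disjoint_frontier_connectedComponentIn {α : Type*} [TopologicalSpace α]
    [LocallyConnectedSpace α] {W : Set α} (hW : IsOpen W) (z : α) :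
    Disjoint (frontier (connectedComponentIn W z)) W := by
  rw [Set.disjoint_left]
  intro x hx hxW
  obtain ⟨y, hyx, hyz⟩ := mem_closure_iff.1 (frontier_subset_closure hx) _
    (hW.connectedComponentIn (x := x)) (mem_connectedComponentIn hxW)
  have hxz : x ∈ connectedComponentIn W z := by
    rw [connectedComponentIn_eq hyz, ← connectedComponentIn_eq hyx]
    exact mem_connectedComponentIn hxW
  rw [hW.connectedComponentIn.frontier_eq] at hx
  exact hx.2 hxz

/-- The maximum principle for the imaginary part of a holomorphic function. -/
theorem Complex.im_nonpos_of_forall_mem_frontier {f : ℂ → ℂ} {U : Set ℂ}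
    (hU : Bornology.IsBounded U) (hf : Differentiable ℂ f)
    (hfr : ∀ z ∈ frontier U, (f z).im ≤ 0) {z : ℂ} (hz : z ∈ U) : (f z).im ≤ 0 := by
  have h := Complex.norm_le_of_forall_mem_frontier_norm_le (C := 1) hU
    (f := fun z => Complex.exp (-Complex.I * f z))
    (Differentiable.diffContOnCl (by fun_prop))
    (fun w hw => by simpa [Complex.norm_exp] using hfr w hw) (subset_closure hz)
  simpa [Complex.norm_exp] using h

/-- A nonempty bounded open set has a boundary point where a given nonconstant polynomial
takes a non-real value. -/
theorem Polynomial.exists_mem_frontier_im_eval_ne_zero {Q : Polynomial ℂ}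
    (hQ : 0 < Q.natDegree) {U : Set ℂ} (hU : Bornology.IsBounded U) (hUo : IsOpen U)
    (hne : U.Nonempty) : ∃ z ∈ frontier U, (Q.eval z).im ≠ 0 := by
  by_contra! hfr
  have hreal : ∀ z ∈ U, (Q.eval z).im = 0 := fun z hz => by
    refine le_antisymm (Complex.im_nonpos_of_forall_mem_frontier hU Q.differentiable
      (fun w hw => (hfr w hw).le) hz) ?_
    have := Complex.im_nonpos_of_forall_mem_frontier (f := fun z => -Q.eval z) hU
      Q.differentiable.neg (fun w hw => by simp [hfr w hw]) hz
    simpa using this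
  obtain ⟨z, hz⟩ := hne
  refine not_isOpen_singleton (0 : ℝ) ?_
  convert Complex.isOpenMap_im _ ((Q.isOpenQuotientMap_eval hQ.ne').isOpenMap U hUo)
  ext t
  simp only [Set.mem_singleton_iff, Set.mem_image, exists_exists_and_eq_and]
  exact ⟨fun h => ⟨z, hz, by rw [hreal z hz, h]⟩, fun ⟨w, hw, h⟩ => by rw [← h, hreal w hw]⟩

/-- The exterior of a closed disc centred at the origin is connected, being the image of a
half-plane under the exponential map. -/
theorem Complex.isConnected_compl_closedBall_zero {R : ℝ} (hR : 0 < R) :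
    IsConnected (Metric.closedBall (0 : ℂ) R)ᶜ := by
  have himage : (Metric.closedBall (0 : ℂ) R)ᶜ = Complex.exp '' {z | Real.log R < z.re} := by
    ext z
    simp only [Set.mem_compl_iff, mem_closedBall_zero_iff, not_le, Set.mem_image,
      Set.mem_ofPred_eq]
    constructor
    · intro hz
      refine ⟨Complex.log z, ?_, Complex.exp_log (norm_pos_iff.1 (hR.trans hz))⟩
      rw [Complex.log_re]
      exact Real.log_lt_log hR hz
    · rintro ⟨w, hw, rfl⟩
      rwa [Complex.norm_exp, ← Real.log_lt_iff_lt_exp hR]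
  have hhalf : IsConnected {z : ℂ | Real.log R < z.re} :=
    ⟨⟨(Real.log R + 1 : ℝ), by simp⟩, (convex_halfSpace_re_gt (Real.log R)).isPreconnected⟩
  rw [himage]
  exact hhalf.image _ Complex.continuous_exp.continuousOn

/-- For every nonconstant polynomial `Q` with complex coefficients, the
complement `ℂ \ Q⁻¹([-2,2])` of the preimage of the real segment `[-2,2]` under `Q` is a
connected subset of `ℂ`.  (In particular, for a quasi-symmetric `p`-periodic Jacobi
matrix `J⁰` with suitably normalized Burchnall–Chaundy polynomial `Q`, so that
`σ(J⁰) = Q⁻¹([-2,2])`, the complement of the spectrum of `J⁰` is connected.) -/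
theorem statement19 (Q : Polynomial ℂ) (hQ : 0 < Q.natDegree) :
    IsConnected {z : ℂ | Polynomial.eval z Q ∉ (fun x : ℝ => (x : ℂ)) '' Set.Icc (-2 : ℝ) 2} := by
  set S : Set ℂ := (fun x : ℝ => (x : ℂ)) '' Set.Icc (-2 : ℝ) 2
  set W : Set ℂ := {z | Polynomial.eval z Q ∉ S}
  have hS : IsCompact S := isCompact_Icc.image Complex.continuous_ofReal
  have hW : IsOpen W := hS.isClosed.isOpen_compl.preimage Q.continuous
  have hWc : Bornology.IsBounded Wᶜ := by
    have : IsCompact (Q.eval ⁻¹' S) := (Q.isProperMap_eval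
      (Polynomial.natDegree_pos_iff_degree_pos.1 hQ)).isCompact_preimage hS
    convert this.isBounded using 1
    ext z
    simp [W]
  obtain ⟨R, hRpos, hR⟩ := hWc.subset_closedBall_lt 0 0
  have hBW : (Metric.closedBall (0 : ℂ) R)ᶜ ⊆ W := Set.compl_subset_comm.1 hR
  have hB := Complex.isConnected_compl_closedBall_zero hRpos
  have hmeet : ∀ z ∈ W, ∃ y ∈ connectedComponentIn W z, y ∉ Metric.closedBall (0 : ℂ) R := by
    intro z hz
    by_contra! hsub
    obtain ⟨x, hx, hxim⟩ := Polynomial.exists_mem_frontier_im_eval_ne_zero hQ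
      (Metric.isBounded_closedBall.subset hsub) hW.connectedComponentIn
      ⟨z, mem_connectedComponentIn hz⟩
    refine Set.disjoint_left.1 (disjoint_frontier_connectedComponentIn hW z) hx ?_
    rintro ⟨t, -, ht⟩
    exact hxim (by rw [← ht]; exact Complex.ofReal_im t)
  obtain ⟨x, hx⟩ := hB.nonempty
  have hWx : W = connectedComponentIn W x := by
    refine Set.Subset.antisymm (fun z hz => ?_) (connectedComponentIn_subset W x)
    obtain ⟨y, hyz, hy⟩ := hmeet z hz
    rw [connectedComponentIn_eq (hB.isPreconnected.subset_connectedComponentIn hx hBW hy),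
      ← connectedComponentIn_eq hyz]
    exact mem_connectedComponentIn hz
  rw [hWx]
  exact isConnected_connectedComponentIn_iff.2 (hBW hx)
end
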